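/- Let n ≥ 1, k ≥ 1, and 1 ≤ t ≤ n be integers. The number of partitions π in NC^k_B(n) that have a zero-block of cardinality 2tk equals binom(n(k+1) − t − 1, nk − 1). -/

import Mathlib

open Finset

/-- A finpartition of a linearly ordered set is non-crossing if there are no
`a < b < c < d` with `a, c` in one block and `b, d` in a different block. -/
def IsNoncrossing {n : ℕ} (π : Finpartition (Finset.univ : Finset (Fin n))) : Prop :=
  ∀ a b c d : Fin n, a < b → b < c → c < d →
    ∀ B ∈ π.parts, ∀ C ∈ π.parts, a ∈ B → c ∈ B → b ∈ C → d ∈ C → B = C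

/-- Filter by an arbitrary (possibly non-decidable) predicate. -/
noncomputable def fil {α : Type*} (s : Finset α) (p : α → Prop) : Finset α :=
  letI := Classical.decPred p
  s.filter p

/-- Negation on `[±n] = {1,…,n,-1,…,-n}`, identified with `Fin (2n)` via
`i ↦ i - 1` and `-i ↦ n + i - 1` (zero-based).  It is given by adding `n` modulo `2n`. -/
def negB {n : ℕ} (x : Fin (2 * n)) : Fin (2 * n) :=
  ⟨(x.val + n) % (2 * n), Nat.mod_lt _ (by have := x.isLt; omega)⟩

/-- `-V` for a block `V`. -/
def negBlock {n : ℕ} (V : Finset (Fin (2 * n))) : Finset (Fin (2 * n)) :=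
  V.image negB

/-- `NCB n` : non-crossing partitions of type `B_n`, i.e. non-crossing partitions
of `[±n]` such that `-V` is a block whenever `V` is, with at most one block `V`
satisfying `-V = V` (the zero-block). -/
noncomputable def NCB (n : ℕ) : Finset (Finpartition (Finset.univ : Finset (Fin (2 * n)))) :=
  fil Finset.univ (fun π => IsNoncrossing π ∧ (∀ B ∈ π.parts, negBlock B ∈ π.parts) ∧
    (π.parts.filter (fun B => negBlock B = B)).card ≤ 1)

/-- The number of unordered pairs `{V, -V}` of non-zero blocks of `π` with `|V| = t`. -/
def pairCount {n : ℕ} (π : Finpartition (Finset.univ : Finset (Fin (2 * n)))) (t : ℕ) : ℕ :=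
  (π.parts.filter (fun B => negBlock B ≠ B ∧ B.card = t)).card / 2

/-- The number of unordered pairs `{V, -V}` of non-zero blocks of `π` (of any size). -/
def totalPairCount {n : ℕ} (π : Finpartition (Finset.univ : Finset (Fin (2 * n)))) : ℕ :=
  (π.parts.filter (fun B => negBlock B ≠ B)).card / 2

/-- The cardinality of the zero-block of `π` (`0` if there is no zero-block). -/
def zeroBlockSize {n : ℕ} (π : Finpartition (Finset.univ : Finset (Fin (2 * n)))) : ℕ :=
  ∑ B ∈ π.parts.filter (fun B => negBlock B = B), B.card

/-- `NCBdiv k n` : the `k`-divisible non-crossing partitions of type `B_{kn}`. -/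
noncomputable def NCBdiv (k n : ℕ) :
    Finset (Finpartition (Finset.univ : Finset (Fin (2 * (k * n))))) :=
  fil (NCB (k * n)) (fun π => ∀ B ∈ π.parts, k ∣ B.card)


/-! ### Abstract opener structures on `ℤ` -/

structure OpAx (m : ℤ) (Z : ℤ → Prop) (o : ℤ → ℤ) : Prop where
  lt : ∀ y, ¬ Z y → y - m < o y
  le : ∀ y, ¬ Z y → o y ≤ y
  perZ : ∀ y, Z (y + m) ↔ Z y
  per : ∀ y, ¬ Z y → o (y + m) = o y + m
  nc : ∀ y w, ¬ Z y → o y ≤ w → w ≤ y → ¬ Z w ∧ o y ≤ o w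

open Classical in
noncomputable def fib (m : ℤ) (Z : ℤ → Prop) (o : ℤ → ℤ) (i : ℤ) : Finset ℤ :=
  (Finset.Ico i (i + m)).filter (fun y => ¬ Z y ∧ o y = i)

theorem mem_fib {m : ℤ} {Z : ℤ → Prop} {o : ℤ → ℤ} {i y : ℤ} :
    y ∈ fib m Z o i ↔ (i ≤ y ∧ y < i + m) ∧ ¬ Z y ∧ o y = i := by
  simp [fib]

theorem fib_disj (m : ℤ) (Z : ℤ → Prop) (o : ℤ → ℤ) (s : Set ℤ) :
    s.PairwiseDisjoint (fib m Z o) := by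
  intro i _ j _ hij
  simp only [Function.onFun]
  rw [Finset.disjoint_left]
  intro y hy hy'
  rw [mem_fib] at hy hy'
  exact hij (hy.2.2.symm.trans hy'.2.2)

open Classical in
theorem sum_fib {m : ℤ} (hm : 0 < m) {Z : ℤ → Prop} {o : ℤ → ℤ} (h : OpAx m Z o) :
    ((∑ i ∈ Finset.Ico 0 m, (fib m Z o i).card : ℕ) : ℤ)
      + ((Finset.Ico 0 m).filter Z).card = m := by
  have h1 : ∑ i ∈ Finset.Ico 0 m, (fib m Z o i).card
      = ((Finset.Ico 0 m).filter (fun y => ¬ Z y)).card := by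
    rw [← Finset.card_biUnion (fun i _ j _ hij => fib_disj m Z o Set.univ (Set.mem_univ i) (Set.mem_univ j) hij)]
    refine Finset.card_bij (fun y _ => if y < m then y else y - m) ?_ ?_ ?_
    · intro y hy
      simp only [Finset.mem_biUnion, mem_fib, Finset.mem_Ico] at hy
      obtain ⟨i, hi, hy, hZ, ho⟩ := hy
      simp only [Finset.mem_filter, Finset.mem_Ico]
      split_ifs with hlt
      · exact ⟨⟨by omega, by omega⟩, hZ⟩
      · refine ⟨⟨by omega, by omega⟩, ?_⟩
        rw [← h.perZ]; simpa using hZ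
    · intro y hy y' hy' hE
      simp only [Finset.mem_biUnion, mem_fib, Finset.mem_Ico] at hy hy'
      obtain ⟨i, hi, hy, hZ, ho⟩ := hy
      obtain ⟨i', hi', hy', hZ', ho'⟩ := hy'
      split_ifs at hE with h1 h2 h2
      · exact hE
      · exfalso
        have := h.per y hZ
        rw [show y + m = y' by omega] at this
        omega
      · exfalso
        have := h.per y' hZ'
        rw [show y' + m = y by omega] at this
        omega
      · omega
    · intro w hw
      simp only [Finset.mem_filter, Finset.mem_Ico] at hw
      obtain ⟨hw, hZ⟩ := hw
      have l1 := h.lt w hZ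
      have l2 := h.le w hZ
      have l3 := h.per w hZ
      have hZ' : ¬ Z (w + m) := by rwa [h.perZ]
      by_cases h0 : 0 ≤ o w
      · refine ⟨w, ?_, by simp [hw.2]⟩
        simp only [Finset.mem_biUnion, mem_fib, Finset.mem_Ico]
        exact ⟨o w, by omega, by omega, hZ, rfl⟩
      · refine ⟨w + m, ?_, by rw [if_neg (by omega)]; ring⟩
        simp only [Finset.mem_biUnion, mem_fib, Finset.mem_Ico]
        exact ⟨o w + m, by omega, by omega, hZ', l3⟩
  rw [h1]
  have := Finset.card_filter_add_card_filter_not (s := Finset.Ico 0 m) Z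
  rw [Int.card_Ico] at this
  omega

/-- The walk. -/
noncomputable def walk (f : ℤ → ℤ) (x : ℤ) : ℤ :=
  ∑ i ∈ Finset.Ico 0 x, f i - ∑ i ∈ Finset.Ico x 0, f i

theorem sum_Ico_succ_right (f : ℤ → ℤ) {a b : ℤ} (h : a ≤ b) :
    ∑ i ∈ Finset.Ico a (b + 1), f i = ∑ i ∈ Finset.Ico a b, f i + f b := by
  have : Finset.Ico a (b + 1) = insert b (Finset.Ico a b) := by
    ext x; simp only [Finset.mem_Ico, Finset.mem_insert]; omega
  rw [this, Finset.sum_insert (by simp)]; ring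

theorem sum_Ico_succ_left (f : ℤ → ℤ) {a b : ℤ} (h : a < b) :
    ∑ i ∈ Finset.Ico a b, f i = f a + ∑ i ∈ Finset.Ico (a + 1) b, f i := by
  have : Finset.Ico a b = insert a (Finset.Ico (a + 1) b) := by
    ext x; simp only [Finset.mem_Ico, Finset.mem_insert]; omega
  rw [this, Finset.sum_insert (by simp)]

theorem walk_succ (f : ℤ → ℤ) (x : ℤ) : walk f (x + 1) = walk f x + f x := by
  unfold walk
  rcases lt_or_ge x 0 with h | h
  · rw [sum_Ico_succ_left f h, Finset.Ico_eq_empty (a := 0) (b := x) (by omega),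
      Finset.Ico_eq_empty (a := 0) (b := x + 1) (by omega)]
    simp
  · rw [sum_Ico_succ_right f h, Finset.Ico_eq_empty (a := x) (b := 0) (by omega),
      Finset.Ico_eq_empty (a := x + 1) (b := 0) (by omega)]
    simp

theorem walk_sub (f : ℤ → ℤ) (x y : ℤ) (h : x ≤ y) :
    walk f y = walk f x + ∑ i ∈ Finset.Ico x y, f i := by
  induction y, h using Int.leInduction with
  | base => simp
  | succ y hy ih => rw [walk_succ, ih, sum_Ico_succ_right f hy]; ring

theorem walk_per (f : ℤ → ℤ) (m : ℤ) (hm : 0 ≤ m) (hf : ∀ x, f (x + m) = f x) (x : ℤ) :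
    walk f (x + m) = walk f x + ∑ i ∈ Finset.Ico 0 m, f i := by
  have key : ∀ x, walk f (x + 1 + m) - walk f (x + 1) = walk f (x + m) - walk f x := by
    intro x
    rw [walk_succ, show x + 1 + m = x + m + 1 by ring, walk_succ, hf]; ring
  have h0 : walk f (0 + m) = walk f 0 + ∑ i ∈ Finset.Ico 0 m, f i := by
    rw [zero_add, walk_sub f 0 m hm]
  have : walk f (x + m) - walk f x = walk f (0 + m) - walk f 0 := by
    induction x using Int.induction_on with
    | zero => rfl
    | succ i ih => rw [key, ih]
    | pred i ih =>
      rw [← ih, ← key]; simp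
  omega

/-- Uniqueness: an opener structure is read off from its walk. -/
theorem OpAx.walk_lt {m : ℤ} {Z : ℤ → Prop} {o : ℤ → ℤ} (h : OpAx m Z o)
    (y j : ℤ) (hj : j ≤ y) (hy : ¬ Z y → o y < j) :
    walk (fun i => ((fib m Z o i).card : ℤ) - 1) (y + 1)
      < walk (fun i => ((fib m Z o i).card : ℤ) - 1) j := by
  rw [walk_sub _ j (y + 1) (by omega), Finset.sum_sub_distrib]
  have h1 : ∑ i ∈ Finset.Ico j (y + 1), (fib m Z o i).card ≤ (Finset.Ico j y).card := by
    rw [← Finset.card_biUnion (fun i _ j _ hij => fib_disj m Z o Set.univ (Set.mem_univ i) (Set.mem_univ j) hij)]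
    apply Finset.card_le_card
    intro w hw
    simp only [Finset.mem_biUnion, mem_fib, Finset.mem_Ico] at hw ⊢
    obtain ⟨i, hi, hw, hZ, ho⟩ := hw
    refine ⟨by omega, ?_⟩
    by_contra hc
    have := h.nc w y hZ (by omega) (by omega)
    have := hy this.1
    omega
  rw [Int.card_Ico] at h1
  have h2 : (∑ i ∈ Finset.Ico j (y + 1), ((fib m Z o i).card : ℤ)) ≤ y - j := by
    rw [← Nat.cast_sum]; omega
  simp only [Finset.sum_const, Int.card_Ico, nsmul_eq_mul, mul_one]
  omega

theorem OpAx.walk_le {m : ℤ} {Z : ℤ → Prop} {o : ℤ → ℤ} (h : OpAx m Z o)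
    (y : ℤ) (hy : ¬ Z y) :
    walk (fun i => ((fib m Z o i).card : ℤ) - 1) (o y)
      ≤ walk (fun i => ((fib m Z o i).card : ℤ) - 1) (y + 1) := by
  have hle := h.le y hy
  rw [walk_sub _ (o y) (y + 1) (by omega), Finset.sum_sub_distrib]
  have h1 : (Finset.Ico (o y) (y + 1)).card ≤ ∑ i ∈ Finset.Ico (o y) (y + 1), (fib m Z o i).card := by
    rw [← Finset.card_biUnion (fun i _ j _ hij => fib_disj m Z o Set.univ (Set.mem_univ i) (Set.mem_univ j) hij)]
    apply Finset.card_le_card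
    intro w hw
    simp only [Finset.mem_biUnion, mem_fib, Finset.mem_Ico] at hw ⊢
    have h1 := h.nc y w hy (by omega) (by omega)
    have h2 := h.lt w h1.1
    have h3 := h.le w h1.1
    exact ⟨o w, by omega, by omega, h1.1, rfl⟩
  rw [Int.card_Ico] at h1
  have h2 : y + 1 - o y ≤ (∑ i ∈ Finset.Ico (o y) (y + 1), ((fib m Z o i).card : ℤ)) := by
    rw [← Nat.cast_sum]; omega
  simp only [Finset.sum_const, Int.card_Ico, nsmul_eq_mul, mul_one]
  omega

theorem OpAx.unique {m : ℤ} {Z Z' : ℤ → Prop} {o o' : ℤ → ℤ} (h : OpAx m Z o)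
    (h' : OpAx m Z' o') (hf : ∀ i, (fib m Z o i).card = (fib m Z' o' i).card) :
    (∀ y, Z y ↔ Z' y) ∧ ∀ y, ¬ Z y → o y = o' y := by
  have hw : (fun i => ((fib m Z o i).card : ℤ) - 1) = fun i => ((fib m Z' o' i).card : ℤ) - 1 := by
    funext i; rw [hf]
  have hZ : ∀ y, Z y ↔ Z' y := by
    intro y
    constructor
    · intro hz
      by_contra hz'
      have h1 := h'.walk_le y hz'
      have h2 := h.walk_lt y (o' y) (h'.le y hz') (fun hc => absurd hz hc)
      rw [hw] at h2; omega
    · intro hz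
      by_contra hz'
      have h1 := h.walk_le y hz'
      have h2 := h'.walk_lt y (o y) (h.le y hz') (fun hc => absurd hz hc)
      rw [← hw] at h2; omega
  refine ⟨hZ, fun y hy => ?_⟩
  have hy' : ¬ Z' y := by rwa [← hZ]
  have h1 := h.walk_le y hy
  have h2 := h'.walk_le y hy'
  have h3 := h.le y hy
  have h4 := h'.le y hy'
  rcases lt_trichotomy (o y) (o' y) with hl | hl | hl
  · have := h.walk_lt y (o' y) h4 (fun _ => hl)
    rw [hw] at this; omega
  · exact hl
  · have := h'.walk_lt y (o y) h3 (fun _ => hl)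
    rw [← hw] at this; omega

/-- Existence: a walk with negative drift gives an opener structure. -/
theorem exists_OpAx {m : ℤ} (hm : 0 < m) (g : ℤ → ℕ) (hg : ∀ x, g (x + m) = g x)
    (hd : ∑ i ∈ Finset.Ico 0 m, ((g i : ℤ) - 1) < 0) :
    ∃ Z : ℤ → Prop, ∃ o : ℤ → ℤ, OpAx m Z o ∧ ∀ i, (fib m Z o i).card = g i := by
  obtain ⟨S, hS⟩ : ∃ S, S = walk (fun i => (g i : ℤ) - 1) := ⟨_, rfl⟩
  obtain ⟨δ, hδ⟩ : ∃ δ, δ = ∑ i ∈ Finset.Ico 0 m, ((g i : ℤ) - 1) := ⟨_, rfl⟩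
  have hs : ∀ x, S (x + 1) = S x + (g x - 1) := by
    intro x; rw [hS, walk_succ]
  have hp : ∀ x, S (x + m) = S x + δ := by
    intro x; rw [hS, hδ]; exact walk_per _ m hm.le (fun x => by rw [hg]) x
  rw [← hδ] at hd
  clear hS hδ
  have hlow : ∀ x h : ℤ, ∃ y, x < y ∧ S y ≤ h := by
    intro x h
    have : ∀ r : ℕ, S (x + m * (r + 1)) ≤ S x - (r + 1) := by
      intro r
      induction r with
      | zero => simp only [Nat.cast_zero, zero_add, mul_one]; rw [hp]; omega
      | succ r ih =>
        push_cast
        rw [show x + m * ((r : ℤ) + 1 + 1) = x + m * (r + 1) + m by ring, hp]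
        omega
    refine ⟨x + m * ((S x - h).toNat + 1), by nlinarith [Int.natCast_nonneg (S x - h).toNat], ?_⟩
    have := this (S x - h).toNat
    omega
  have hex : ∀ y, ∃ j, (∃ j' ≤ y, S j' ≤ S (y + 1)) →
      (j ≤ y ∧ S j ≤ S (y + 1)) ∧ ∀ i, (i ≤ y ∧ S i ≤ S (y + 1)) → i ≤ j := by
    intro y
    by_cases hc : ∃ j' ≤ y, S j' ≤ S (y + 1)
    · obtain ⟨j, h1, h2⟩ := Int.exists_greatest_of_bdd (P := fun j => j ≤ y ∧ S j ≤ S (y + 1))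
        ⟨y, fun z hz => hz.1⟩ hc
      exact ⟨j, fun _ => ⟨h1, h2⟩⟩
    · exact ⟨0, fun h => absurd h hc⟩
  choose o ho using hex
  have hax : OpAx m (fun y => ¬ ∃ j' ≤ y, S j' ≤ S (y + 1)) o := by
    have hpz : ∀ y, (∃ j' ≤ y + m, S j' ≤ S (y + m + 1)) ↔ (∃ j' ≤ y, S j' ≤ S (y + 1)) := by
      intro y
      have e := hp (y + 1)
      rw [show y + 1 + m = y + m + 1 by ring] at e
      constructor
      · rintro ⟨j, h1, h2⟩
        refine ⟨j - m, by omega, ?_⟩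
        have := hp (j - m)
        rw [sub_add_cancel] at this; omega
      · rintro ⟨j, h1, h2⟩
        exact ⟨j + m, by omega, by rw [hp]; omega⟩
    refine ⟨?_, ?_, ?_, ?_, ?_⟩
    · intro y hy
      obtain ⟨⟨h1, h2⟩, h3⟩ := ho y (not_not.1 hy)
      by_contra hc
      have := h3 (o y + m) ⟨by omega, by rw [hp]; omega⟩
      omega
    · intro y hy
      exact (ho y (not_not.1 hy)).1.1
    · intro y
      rw [hpz]
    · intro y hy
      have hy := not_not.1 hy
      obtain ⟨⟨h1, h2⟩, h3⟩ := ho y hy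
      obtain ⟨⟨k1, k2⟩, k3⟩ := ho (y + m) ((hpz y).2 hy)
      have e := hp (y + 1)
      rw [show y + 1 + m = y + m + 1 by ring] at e
      have := k3 (o y + m) ⟨by omega, by rw [hp]; omega⟩
      have e2 := hp (o (y + m) - m)
      rw [sub_add_cancel] at e2
      have := h3 (o (y + m) - m) ⟨by omega, by omega⟩
      omega
    · intro y w hy h1 h2
      have hy := not_not.1 hy
      obtain ⟨⟨g1, g2⟩, g3⟩ := ho y hy
      rcases eq_or_lt_of_le h2 with rfl | h2
      · exact ⟨not_not.2 hy, le_rfl⟩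
      have hlt : S (y + 1) < S (w + 1) := by
        by_contra hc
        have := g3 (w + 1) ⟨by omega, by omega⟩
        omega
      have hw : ∃ j' ≤ w, S j' ≤ S (w + 1) := ⟨o y, h1, by omega⟩
      exact ⟨not_not.2 hw, (ho w hw).2 _ ⟨h1, by omega⟩⟩
  refine ⟨_, o, hax, ?_⟩
  intro i
  have : (Finset.Ico (S i) (S i + g i)).card = g i := by simp
  rw [← this]
  refine Finset.card_bij (fun y _ => S (y + 1)) ?_ ?_ ?_
  · intro y hy
    rw [mem_fib] at hy
    obtain ⟨⟨h1, h2⟩, hZ, rfl⟩ := hy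
    obtain ⟨⟨g1, g2⟩, g3⟩ := ho y (not_not.1 hZ)
    rw [Finset.mem_Ico]
    refine ⟨g2, ?_⟩
    have := hs (o y)
    rcases eq_or_lt_of_le h1 with he | he
    · rw [he] at this; rw [he]; omega
    · by_contra hc
      have := g3 (o y + 1) ⟨by omega, by omega⟩
      omega
  · intro y hy y' hy' hE
    rw [mem_fib] at hy hy'
    obtain ⟨⟨h1, h2⟩, hZ, h3⟩ := hy
    obtain ⟨⟨h1', h2'⟩, hZ', h3'⟩ := hy'
    have g := (ho y (not_not.1 hZ)).2
    have g' := (ho y' (not_not.1 hZ')).2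
    rcases lt_trichotomy y y' with hl | hl | hl
    · have := g' (y + 1) ⟨by omega, by omega⟩
      omega
    · exact hl
    · have := g (y' + 1) ⟨by omega, by omega⟩
      omega
  · intro h hh
    rw [Finset.mem_Ico] at hh
    obtain ⟨y, ⟨hy1, hy2⟩, hy3⟩ := Int.exists_least_of_bdd (P := fun y => i < y ∧ S y ≤ h)
        ⟨i, fun z hz => hz.1.le⟩ (hlow i h)
    have hs1 := hs (y - 1)
    rw [sub_add_cancel] at hs1
    have hSy : S y = h := by
      by_cases he : y - 1 = i
      · rw [he] at hs1; omega
      · have : ¬ S (y - 1) ≤ h := by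
          intro hc
          have := hy3 (y - 1) ⟨by omega, hc⟩
          omega
        omega
    have hnZ : ∃ j' ≤ y - 1, S j' ≤ S (y - 1 + 1) := by
      rw [sub_add_cancel]; exact ⟨i, by omega, by omega⟩
    have hoi : o (y - 1) = i := by
      obtain ⟨⟨g1, g2⟩, g3⟩ := ho (y - 1) hnZ
      rw [sub_add_cancel] at g2 g3
      have := g3 i ⟨by omega, by omega⟩
      by_contra hne
      have := hy3 (o (y - 1)) ⟨by omega, by omega⟩
      omega
    refine ⟨y - 1, ?_, by rw [sub_add_cancel, hSy]⟩
    rw [mem_fib]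
    have := hax.lt (y - 1) (not_not.2 hnZ)
    exact ⟨⟨by omega, by omega⟩, not_not.2 hnZ, hoi⟩

/-! ### Relations on `ℤ` and opener structures -/

structure RelAx (m : ℤ) (R : ℤ → ℤ → Prop) : Prop where
  refl : ∀ x, R x x
  symm : ∀ x y, R x y → R y x
  trans : ∀ x y z, R x y → R y z → R x z
  per2 : ∀ x, R x (x + 2 * m)
  per : ∀ x y, R x y → R (x + m) (y + m)
  nc : ∀ a b c d, a < b → b < c → c < d → d < a + 2 * m → R a c → R b d → R a b

def RZ (m : ℤ) (R : ℤ → ℤ → Prop) (x : ℤ) : Prop := R x (x + m)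

noncomputable def Ro (m : ℤ) (R : ℤ → ℤ → Prop) (x : ℤ) : ℤ := sInf {y | x - m < y ∧ R y x}

def Link (m : ℤ) (R : ℤ → ℤ → Prop) (Z : ℤ → Prop) (o : ℤ → ℤ) : Prop :=
  ∀ x y, R x y ↔ (Z x ∧ Z y) ∨ (¬ Z x ∧ ¬ Z y ∧ ∃ q : ℤ, o x = o y + q * (2 * m))

theorem Ro_le (m : ℤ) (R : ℤ → ℤ → Prop) (x y : ℤ) (h1 : x - m < y) (h2 : R y x) :
    Ro m R x ≤ y :=
  csInf_le ⟨x - m, fun _ hz => hz.1.le⟩ ⟨h1, h2⟩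

theorem Ro_mem {m : ℤ} (hm : 0 < m) {R : ℤ → ℤ → Prop} (h : RelAx m R) (x : ℤ) :
    x - m < Ro m R x ∧ R (Ro m R x) x :=
  Int.csInf_mem (s := {y | x - m < y ∧ R y x}) ⟨x, by omega, h.refl x⟩
    ⟨x - m, fun _ hz => hz.1.le⟩

theorem RelAx.perq {m : ℤ} {R : ℤ → ℤ → Prop} (h : RelAx m R) (x q : ℤ) :
    R x (x + q * (2 * m)) := by
  induction q using Int.induction_on with
  | zero => simpa using h.refl x
  | succ i ih =>
    have := h.trans _ _ _ ih (h.per2 _)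
    convert this using 1; ring
  | pred i ih =>
    have e := h.per2 (x + (-(i : ℤ) - 1) * (2 * m))
    rw [show x + (-(i : ℤ) - 1) * (2 * m) + 2 * m = x + (-(i : ℤ)) * (2 * m) by ring] at e
    exact h.trans _ _ _ ih (h.symm _ _ e)

theorem RelAx.Z_congr {m : ℤ} {R : ℤ → ℤ → Prop} (h : RelAx m R) {x y : ℤ} (hxy : R x y)
    (hx : RZ m R x) : RZ m R y :=
  h.trans _ _ _ (h.symm _ _ hxy) (h.trans _ _ _ hx (h.per _ _ hxy))

theorem RelAx.perZ {m : ℤ} {R : ℤ → ℤ → Prop} (h : RelAx m R) (x : ℤ) :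
    RZ m R (x + m) ↔ RZ m R x := by
  unfold RZ
  constructor
  · intro hx
    have h2 := h.per2 x
    rw [show x + 2 * m = x + m + m by ring] at h2
    exact h.trans _ _ _ h2 (h.symm _ _ hx)
  · intro hx
    exact h.per _ _ hx

theorem RelAx.per' {m : ℤ} {R : ℤ → ℤ → Prop} (h : RelAx m R) {x y : ℤ}
    (hx : R (x + m) (y + m)) : R x y := by
  have := h.per _ _ hx
  have a := h.per2 x
  have b := h.per2 y
  rw [show x + 2 * m = x + m + m by ring] at a
  rw [show y + 2 * m = y + m + m by ring] at b
  exact h.trans _ _ _ a (h.trans _ _ _ this (h.symm _ _ b))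

/-- `L`-transitivity. -/
theorem RelAx.far {m : ℤ} {R : ℤ → ℤ → Prop} (h : RelAx m R) {i w y : ℤ}
    (h1 : i < w) (h2 : w < y) (h3 : w < i + m) (h4 : y < w + m) (hiw : R i w) (hwy : R w y)
    (hZ : ¬ RZ m R y) : y < i + m := by
  by_contra hc
  have hiy := h.trans _ _ _ hiw hwy
  rcases eq_or_lt_of_le (not_lt.1 hc) with he | he
  · apply hZ
    refine h.Z_congr hiy ?_
    unfold RZ
    rw [he]; exact hiy
  · have hc := h.nc w (i + m) y (y + m) h3 he (by omega) (by omega) hwy (h.per _ _ hiy)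
    apply hZ
    refine h.Z_congr hiy ?_
    exact h.trans _ _ _ hiw hc

theorem RelAx.opAx {m : ℤ} (hm : 0 < m) {R : ℤ → ℤ → Prop} (h : RelAx m R) :
    OpAx m (RZ m R) (Ro m R) := by
  have hle : ∀ y, Ro m R y ≤ y := fun y => Ro_le m R y y (by omega) (h.refl y)
  refine ⟨fun y _ => (Ro_mem hm h y).1, fun y _ => hle y, h.perZ, ?_, ?_⟩
  · intro y _
    have a := Ro_mem hm h y
    have b := Ro_mem hm h (y + m)
    have c := Ro_le m R (y + m) (Ro m R y + m) (by omega) (h.per _ _ a.2)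
    have d := Ro_le m R y (Ro m R (y + m) - m) (by omega)
      (h.per' (by rw [sub_add_cancel]; exact b.2))
    omega
  · intro y w hy h1 h2
    obtain ⟨a1, a2⟩ := Ro_mem hm h y
    obtain ⟨b1, b2⟩ := Ro_mem hm h w
    have hw : ¬ RZ m R w := by
      intro hw
      rcases eq_or_lt_of_le h1 with e | e
      · rw [← e] at hw; exact hy (h.Z_congr a2 hw)
      rcases eq_or_lt_of_le h2 with e' | e'
      · rw [e'] at hw; exact hy hw
      have := h.nc (Ro m R y) w y (w + m) e e' (by omega) (by omega) a2 hw
      exact hy (h.Z_congr a2 (h.Z_congr (h.symm _ _ this) hw))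
    refine ⟨hw, ?_⟩
    by_contra hc
    rw [not_le] at hc
    have hiy : R (Ro m R w) (Ro m R y) := by
      rcases eq_or_lt_of_le h1 with e | e
      · rw [← e] at b2; rw [← e]; exact b2
      rcases eq_or_lt_of_le h2 with e' | e'
      · rw [e']; exact h.refl _
      exact h.nc _ _ w y hc e e' (by omega) b2 a2
    have hiy' := h.trans _ _ _ hiy a2
    have : y - m < Ro m R w := by
      rcases eq_or_lt_of_le h2 with e' | e'
      · rw [← e']; exact b1
      have hwy : R w y := h.trans _ _ _ (h.symm _ _ b2) hiy'
      have := h.far (i := Ro m R w) (w := w) (y := y) (by omega) e' (by omega) (by omega) b2 hwy hy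
      omega
    have := Ro_le m R y _ this hiy'
    omega

theorem exists_shift {m : ℤ} (hm : 0 < m) (x y : ℤ) :
    ∃ q : ℤ, x - m ≤ y + q * (2 * m) ∧ y + q * (2 * m) < x + m := by
  have e := Int.emod_add_mul_ediv (y - (x - m)) (2 * m)
  have e1 := Int.emod_nonneg (y - (x - m)) (b := 2 * m) (by omega)
  have e2 := Int.emod_lt_of_pos (y - (x - m)) (b := 2 * m) (by omega)
  refine ⟨-((y - (x - m)) / (2 * m)), ?_, ?_⟩ <;> nlinarith

theorem OpAx.perq {m : ℤ} {Z : ℤ → Prop} {o : ℤ → ℤ} (h : OpAx m Z o) (x q : ℤ) :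
    (Z (x + q * (2 * m)) ↔ Z x) ∧ (¬ Z x → o (x + q * (2 * m)) = o x + q * (2 * m)) := by
  have key : ∀ x, (Z (x + 2 * m) ↔ Z x) ∧ (¬ Z x → o (x + 2 * m) = o x + 2 * m) := by
    intro x
    rw [show x + 2 * m = x + m + m by ring]
    refine ⟨by rw [h.perZ, h.perZ], fun hx => ?_⟩
    rw [h.per _ (by rwa [h.perZ]), h.per _ hx]; ring
  induction q using Int.induction_on with
  | zero => simp
  | succ i ih =>
    have := key (x + i * (2 * m))
    rw [show x + ((i : ℤ) + 1) * (2 * m) = x + i * (2 * m) + 2 * m by ring]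
    refine ⟨by rw [this.1, ih.1], fun hx => ?_⟩
    rw [this.2 (by rwa [ih.1]), ih.2 hx]; ring
  | pred i ih =>
    have := key (x + (-(i : ℤ) - 1) * (2 * m))
    rw [show x + (-(i : ℤ) - 1) * (2 * m) + 2 * m = x + (-(i : ℤ)) * (2 * m) by ring] at this
    refine ⟨by rw [← this.1, ih.1], fun hx => ?_⟩
    have h2 := this.2 (by rwa [← this.1, ih.1])
    rw [ih.2 hx] at h2
    linarith

theorem RelAx.link {m : ℤ} (hm : 0 < m) {R : ℤ → ℤ → Prop} (h : RelAx m R) :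
    Link m R (RZ m R) (Ro m R) := by
  have hax := h.opAx hm
  have main : ∀ x y, x ≤ y → y < x + m → R x y → ¬ RZ m R x → ¬ RZ m R y → Ro m R x = Ro m R y := by
    intro x y h1 h2 hxy hx hy
    obtain ⟨a1, a2⟩ := Ro_mem hm h y
    have b := Ro_le m R y x (by omega) hxy
    have c := hax.nc y x hy b h1
    have d := Ro_le m R x (Ro m R y) (by omega) (h.trans _ _ _ a2 (h.symm _ _ hxy))
    omega
  intro x y
  constructor
  · intro hxy
    by_cases hx : RZ m R x
    · exact Or.inl ⟨hx, h.Z_congr hxy hx⟩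
    · have hy : ¬ RZ m R y := fun hy => hx (h.Z_congr (h.symm _ _ hxy) hy)
      refine Or.inr ⟨hx, hy, ?_⟩
      obtain ⟨q, q1, q2⟩ := exists_shift hm x y
      have hp := hax.perq y q
      have hxy' := h.trans _ _ _ hxy (h.perq y q)
      have hy' : ¬ RZ m R (y + q * (2 * m)) := by rwa [hp.1]
      refine ⟨q, ?_⟩
      rw [← hp.2 hy]
      rcases le_total x (y + q * (2 * m)) with hl | hl
      · exact main _ _ hl q2 hxy' hx hy'
      · refine (main _ _ hl ?_ (h.symm _ _ hxy') hy' hx).symm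
        rcases eq_or_lt_of_le q1 with e | e
        · exfalso
          apply hx
          rw [← h.perZ] at hy'
          have : RZ m R (x - m) := by
            unfold RZ
            rw [sub_add_cancel]
            rw [← e] at hxy'
            exact h.symm _ _ hxy'
          have h3 := h.perZ (x - m)
          rw [sub_add_cancel] at h3
          exact h3.2 this
        · omega
  · rintro (⟨hx, hy⟩ | ⟨hx, hy, q, hq⟩)
    · obtain ⟨q, q1, q2⟩ := exists_shift hm x y
      refine h.trans _ _ _ ?_ (h.symm _ _ (h.perq y q))
      have hy' := h.Z_congr (h.perq y q) hy
      generalize y + q * (2 * m) = w at *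
      rcases lt_trichotomy x w with hl | hl | hl
      · exact h.nc x w (x + m) (w + m) hl q2 (by omega) (by omega) hx hy'
      · rw [hl]; exact h.refl _
      · rcases eq_or_lt_of_le q1 with e | e
        · unfold RZ at hy'
          rw [← e, sub_add_cancel] at hy'
          rw [← e]; exact h.symm _ _ hy'
        · exact h.symm _ _ (h.nc w x (w + m) (x + m) hl (by omega) (by omega) (by omega) hy' hx)
    · have a := (Ro_mem hm h x).2
      have b := (Ro_mem hm h y).2
      rw [hq] at a
      exact h.trans _ _ _ (h.symm _ _ a) (h.trans _ _ _ (h.symm _ _ (h.perq _ q)) b)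

theorem Link.Z_iff {m : ℤ} (hm : 0 < m) {R : ℤ → ℤ → Prop} {Z : ℤ → Prop} {o : ℤ → ℤ}
    (hl : Link m R Z o) (h : OpAx m Z o) (x : ℤ) : RZ m R x ↔ Z x := by
  unfold RZ
  rw [hl, h.perZ]
  constructor
  · rintro (h1 | ⟨h1, h2, q, hq⟩)
    · exact h1.1
    · exfalso
      rw [h.per x h1] at hq
      have : m * (1 + q * 2) = 0 := by linarith
      rcases mul_eq_zero.1 this with h | h <;> omega
  · exact fun h => Or.inl ⟨h, h⟩

theorem q_cases {m d q : ℤ} (hm : 0 < m) (h : d = q * (2 * m)) (h1 : -(4 * m) < d)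
    (h2 : d < 4 * m) : d = 0 ∨ d = 2 * m ∨ d = - (2 * m) := by
  have a : -2 < q := by nlinarith
  have b : q < 2 := by nlinarith
  have : q = -1 ∨ q = 0 ∨ q = 1 := by omega
  rcases this with rfl | rfl | rfl <;> omega

theorem Link.o_eq {m : ℤ} (hm : 0 < m) {R : ℤ → ℤ → Prop} {Z : ℤ → Prop} {o : ℤ → ℤ}
    (hl : Link m R Z o) (h : OpAx m Z o) (x : ℤ) (hx : ¬ Z x) : Ro m R x = o x := by
  have l1 := h.lt x hx
  have l2 := h.le x hx
  have hnc := h.nc x (o x) hx le_rfl l2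
  have l3 := h.le _ hnc.1
  apply le_antisymm
  · apply Ro_le _ _ _ _ l1
    rw [hl]
    exact Or.inr ⟨hnc.1, hx, 0, by omega⟩
  · have hmem : x - m < Ro m R x ∧ R (Ro m R x) x :=
      Int.csInf_mem (s := {y | x - m < y ∧ R y x}) ⟨x, by omega, by
        rw [hl]; exact Or.inr ⟨hx, hx, 0, by simp⟩⟩ ⟨x - m, fun _ hz => hz.1.le⟩
    have hle : Ro m R x ≤ x := Ro_le _ _ _ _ (by omega) (by
        rw [hl]; exact Or.inr ⟨hx, hx, 0, by simp⟩)
    obtain ⟨a, b⟩ := hmem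
    rw [hl] at b
    rcases b with b | ⟨b1, b2, q, hq⟩
    · exact absurd b.2 hx
    · have c1 := h.lt _ b1
      have c2 := h.le _ b1
      have := q_cases hm (d := o (Ro m R x) - o x) (q := q) (by omega) (by omega) (by omega)
      omega

theorem Link.fib_eq {m : ℤ} (hm : 0 < m) {R : ℤ → ℤ → Prop} {Z : ℤ → Prop} {o : ℤ → ℤ}
    (hl : Link m R Z o) (h : OpAx m Z o) (i : ℤ) : fib m (RZ m R) (Ro m R) i = fib m Z o i := by
  ext y
  rw [mem_fib, mem_fib, hl.Z_iff hm h]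
  constructor
  · rintro ⟨a, b, c⟩; exact ⟨a, b, by rw [← hl.o_eq hm h y b]; exact c⟩
  · rintro ⟨a, b, c⟩; exact ⟨a, b, by rw [hl.o_eq hm h y b]; exact c⟩

/-- Linear non-crossing of the relation attached to an opener structure. -/
theorem OpAx.noncrossing {m : ℤ} (hm : 0 < m) {Z : ℤ → Prop} {o : ℤ → ℤ} (h : OpAx m Z o)
    {R : ℤ → ℤ → Prop} (hl : Link m R Z o) (a b c d : ℤ) (h0 : 0 ≤ a) (hab : a < b) (hbc : b < c)
    (hcd : c < d) (hd : d < 2 * m) (hac : R a c) (hbd : R b d) : R a b := by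
  rw [hl] at hac hbd ⊢
  rcases hac with ⟨ha, hc⟩ | ⟨ha, hc, q, hq⟩ <;> rcases hbd with ⟨hb, hd'⟩ | ⟨hb, hd', r, hr⟩
  · exact Or.inl ⟨ha, hb⟩
  · exfalso
    have b1 := h.lt b hb
    have b2 := h.le b hb
    have d1 := h.lt d hd'
    have d2 := h.le d hd'
    have := q_cases hm (d := o b - o d) (q := r) (by omega) (by omega) (by omega)
    have e1 : a < o b := by
      by_contra hcon
      exact (h.nc b a hb (by omega) (by omega)).1 ha
    have e2 : c < o d := by
      by_contra hcon
      exact (h.nc d c hd' (by omega) (by omega)).1 hc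
    omega
  · exfalso
    have b1 := h.lt a ha
    have b2 := h.le a ha
    have d1 := h.lt c hc
    have d2 := h.le c hc
    have := q_cases hm (d := o a - o c) (q := q) (by omega) (by omega) (by omega)
    have e1 : d - 2 * m < o a := by
      by_contra hcon
      have := (h.nc a (d - 2 * m) ha (by omega) (by omega)).1
      have e := (h.perq d (-1)).1
      rw [show d + -1 * (2 * m) = d - 2 * m by ring] at e
      exact this (e.2 hd')
    have e2 : b < o c := by
      by_contra hcon
      exact (h.nc c b hc (by omega) (by omega)).1 hb
    omega
  · refine Or.inr ⟨ha, hb, ?_⟩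
    have a1 := h.lt a ha
    have a2 := h.le a ha
    have b1 := h.lt b hb
    have b2 := h.le b hb
    have c1 := h.lt c hc
    have c2 := h.le c hc
    have d1 := h.lt d hd'
    have d2 := h.le d hd'
    have k1 := q_cases hm (d := o a - o c) (q := q) (by omega) (by omega) (by omega)
    have k2 := q_cases hm (d := o b - o d) (q := r) (by omega) (by omega) (by omega)
    have n1 := fun x => (h.nc c b hc x hbc.le).2
    have n2 := fun x => (h.nc d c hd' x hcd.le).2
    have n3 := fun x => (h.nc b a hb x hab.le).2
    have pa := h.perq a 1
    rw [one_mul] at pa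
    have pa2 := pa.2 ha
    have n4 := fun x => (h.nc (a + 2 * m) d (by rw [pa.1]; exact ha) x (by omega)).2
    rw [pa2] at n4
    have : o a = o b ∨ o a = o b - 2 * m := by omega
    rcases this with e | e
    · exact ⟨0, by omega⟩
    · exact ⟨-1, by omega⟩

/-! ### Transfer between `Fin (2 * M)` and `ℤ` -/

def cc (M : ℕ) (hM : 0 < M) (x : ℤ) : Fin (2 * M) :=
  ⟨(x % (2 * (M : ℤ))).toNat, by
    have e1 := Int.emod_nonneg x (b := 2 * (M : ℤ)) (by omega)
    have e2 := Int.emod_lt_of_pos x (b := 2 * (M : ℤ)) (by omega)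
    omega⟩

theorem cc_val {M : ℕ} (hM : 0 < M) (x : ℤ) :
    ∃ q : ℤ, ((cc M hM x).val : ℤ) = x + q * (2 * (M : ℤ)) := by
  refine ⟨-(x / (2 * (M : ℤ))), ?_⟩
  have e1 := Int.emod_nonneg x (b := 2 * (M : ℤ)) (by omega)
  have e := Int.emod_add_mul_ediv x (2 * (M : ℤ))
  simp only [cc]
  rw [Int.toNat_of_nonneg e1]
  linarith

theorem cc_of {M : ℕ} (hM : 0 < M) (x q : ℤ) (u : Fin (2 * M))
    (h : (u.val : ℤ) = x + q * (2 * (M : ℤ))) : cc M hM x = u := by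
  apply Fin.ext
  have hu := u.isLt
  have : x % (2 * (M : ℤ)) = u.val := by
    rw [show x = (u.val : ℤ) + (2 * (M : ℤ)) * (-q) by linarith, Int.add_mul_emod_self_left]
    exact Int.emod_eq_of_lt (by omega) (by omega)
  simp only [cc, this]
  omega

theorem cc_coe {M : ℕ} (hM : 0 < M) (u : Fin (2 * M)) : cc M hM (u.val : ℤ) = u :=
  cc_of hM _ 0 u (by simp)

theorem cc_shift {M : ℕ} (hM : 0 < M) (x q : ℤ) :
    cc M hM (x + q * (2 * (M : ℤ))) = cc M hM x := by
  obtain ⟨r, hr⟩ := cc_val hM x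
  exact cc_of hM _ (r - q) _ (by rw [hr]; ring)

theorem negB_cc {M : ℕ} (hM : 0 < M) (x : ℤ) : negB (cc M hM x) = cc M hM (x + M) := by
  obtain ⟨r, hr⟩ := cc_val hM x
  symm
  have hu := (cc M hM x).isLt
  by_cases hc : (cc M hM x).val < M
  · apply cc_of hM _ r
    simp only [negB]
    rw [Nat.mod_eq_of_lt (by omega)]
    push_cast; linarith
  · apply cc_of hM _ (r - 1)
    simp only [negB]
    rw [Nat.mod_eq_sub_mod (by omega), Nat.mod_eq_of_lt (by omega), Nat.cast_sub (by omega)]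
    push_cast; linarith

theorem negB_negB {M : ℕ} (u : Fin (2 * M)) : negB (negB u) = u := by
  have hM : 0 < M := by have := u.isLt; omega
  rw [← cc_coe hM u, negB_cc, negB_cc]
  have := cc_shift hM (u.val : ℤ) 1
  rw [← this]; congr 1; ring

def PR (M : ℕ) (hM : 0 < M) (π : Finpartition (Finset.univ : Finset (Fin (2 * M)))) (x y : ℤ) :
    Prop := π.part (cc M hM x) = π.part (cc M hM y)

theorem mem_part_iff {N : ℕ} (π : Finpartition (Finset.univ : Finset (Fin N))) (u v : Fin N) :
    u ∈ π.part v ↔ π.part u = π.part v :=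
  π.mem_part_iff_part_eq_part (Finset.mem_univ u) (Finset.mem_univ v)

theorem exists_part {N : ℕ} (π : Finpartition (Finset.univ : Finset (Fin N))) {B : Finset (Fin N)}
    (hB : B ∈ π.parts) : ∃ u, B = π.part u := by
  obtain ⟨u, hu⟩ := π.nonempty_of_mem_parts hB
  exact ⟨u, (π.part_eq_of_mem hB hu).symm⟩

theorem part_mem' {N : ℕ} (π : Finpartition (Finset.univ : Finset (Fin N))) (u : Fin N) :
    π.part u ∈ π.parts := π.part_mem.2 (Finset.mem_univ u)

theorem neg_part_of_closed {M : ℕ} (π : Finpartition (Finset.univ : Finset (Fin (2 * M))))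
    (h : ∀ B ∈ π.parts, negBlock B ∈ π.parts) (u : Fin (2 * M)) :
    negBlock (π.part u) = π.part (negB u) :=
  (π.part_eq_of_mem (h _ (part_mem' π u))
    (Finset.mem_image_of_mem _ (π.mem_part_self.2 (Finset.mem_univ u)))).symm

theorem neg_part_of_congr {M : ℕ} (π : Finpartition (Finset.univ : Finset (Fin (2 * M))))
    (h : ∀ u v, π.part u = π.part v → π.part (negB u) = π.part (negB v)) (u : Fin (2 * M)) :
    negBlock (π.part u) = π.part (negB u) := by
  ext v
  rw [mem_part_iff, negBlock, Finset.mem_image]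
  constructor
  · rintro ⟨w, hw, rfl⟩
    exact h _ _ ((mem_part_iff π _ _).1 hw)
  · intro hv
    refine ⟨negB v, ?_, negB_negB v⟩
    rw [mem_part_iff]
    simpa [negB_negB] using h _ _ hv

theorem zeroBlockSize_eq {M : ℕ} (π : Finpartition (Finset.univ : Finset (Fin (2 * M))))
    (h : ∀ u, negBlock (π.part u) = π.part (negB u)) :
    zeroBlockSize π = (Finset.univ.filter (fun u => π.part (negB u) = π.part u)).card := by
  unfold zeroBlockSize
  rw [Finset.card_eq_sum_card_fiberwise (f := π.part)
    (t := π.parts.filter (fun B => negBlock B = B))]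
  · apply Finset.sum_congr rfl
    intro B hB
    rw [Finset.mem_filter] at hB
    congr 1
    ext v
    simp only [Finset.mem_filter, Finset.mem_univ, true_and]
    rw [π.part_eq_iff_mem hB.1]
    constructor
    · intro hv
      refine ⟨?_, hv⟩
      rw [← h, π.part_eq_of_mem hB.1 hv, hB.2]
    · exact fun hv => hv.2
  · intro u hu
    simp only [Finset.coe_filter, Finset.mem_univ, true_and, Set.mem_ofPred_eq] at hu ⊢
    exact ⟨part_mem' π u, by rw [h, hu]⟩

open Classical in
theorem card_zero {M : ℕ} (hM : 0 < M) (π : Finpartition (Finset.univ : Finset (Fin (2 * M))))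
    (hper : ∀ x, RZ M (PR M hM π) (x + M) ↔ RZ M (PR M hM π) x) :
    (Finset.univ.filter (fun u => π.part (negB u) = π.part u)).card
      = 2 * ((Finset.Ico (0 : ℤ) M).filter (RZ M (PR M hM π))).card := by
  have hZ : ∀ u : Fin (2 * M), π.part (negB u) = π.part u ↔ RZ M (PR M hM π) (u.val : ℤ) := by
    intro u
    unfold RZ PR
    rw [← negB_cc, cc_coe, eq_comm]
  have h1 : (Finset.univ.filter (fun u => π.part (negB u) = π.part u)).card
      = ((Finset.Ico (0 : ℤ) (2 * M)).filter (RZ M (PR M hM π))).card := by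
    refine Finset.card_bij (fun u _ => (u.val : ℤ)) ?_ ?_ ?_
    · intro u hu
      have := u.isLt
      simp only [Finset.mem_filter, Finset.mem_univ, true_and, Finset.mem_Ico] at hu ⊢
      exact ⟨⟨by omega, by omega⟩, (hZ u).1 hu⟩
    · intro u _ v _ huv
      exact Fin.ext (by exact_mod_cast huv)
    · intro y hy
      simp only [Finset.mem_filter, Finset.mem_Ico] at hy
      have e : ((⟨y.toNat, by omega⟩ : Fin (2 * M)).val : ℤ) = y := by
        simp only; omega
      refine ⟨⟨y.toNat, by omega⟩, ?_, e⟩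
      simp only [Finset.mem_filter, Finset.mem_univ, true_and]
      rw [hZ, e]; exact hy.2
  have h2 : ((Finset.Ico (M : ℤ) (2 * M)).filter (RZ M (PR M hM π))).card
      = ((Finset.Ico (0 : ℤ) M).filter (RZ M (PR M hM π))).card := by
    symm
    refine Finset.card_bij (fun u _ => u + M) ?_ ?_ ?_
    · intro u hu
      simp only [Finset.mem_filter, Finset.mem_Ico] at hu ⊢
      exact ⟨⟨by omega, by omega⟩, (hper u).2 hu.2⟩
    · intro u _ v _ huv
      simpa using huv
    · intro y hy
      simp only [Finset.mem_filter, Finset.mem_Ico] at hy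
      refine ⟨y - M, ?_, by simp⟩
      simp only [Finset.mem_filter, Finset.mem_Ico]
      refine ⟨⟨by omega, by omega⟩, ?_⟩
      rw [← hper, sub_add_cancel]; exact hy.2
  rw [h1, ← Finset.Ico_union_Ico_eq_Ico (a := (0 : ℤ)) (b := M) (c := 2 * M) (by omega) (by omega),
    Finset.filter_union, Finset.card_union_of_disjoint, h2, two_mul]
  exact Finset.disjoint_filter_filter (Finset.Ico_disjoint_Ico_consecutive _ _ _)

theorem PR_relAx {M : ℕ} (hM : 0 < M) (π : Finpartition (Finset.univ : Finset (Fin (2 * M))))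
    (hnc : IsNoncrossing π) (hneg : ∀ B ∈ π.parts, negBlock B ∈ π.parts) :
    RelAx M (PR M hM π) := by
  have hp : ∀ x q : ℤ, PR M hM π x (x + q * (2 * (M : ℤ))) := by
    intro x q
    unfold PR; rw [cc_shift]
  have hsymm : ∀ x y, PR M hM π x y → PR M hM π y x := fun x y h => Eq.symm h
  have htrans : ∀ x y z, PR M hM π x y → PR M hM π y z → PR M hM π x z :=
    fun x y z h h' => Eq.trans h h'
  have hlin : ∀ a b c d : ℤ, 0 ≤ a → a < b → b < c → c < d → d < 2 * M → PR M hM π a c →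
      PR M hM π b d → PR M hM π a b := by
    intro a b c d h0 h1 h2 h3 h4 hac hbd
    have e : ∀ x : ℤ, 0 ≤ x → x < 2 * M → ((cc M hM x).val : ℤ) = x := by
      intro x hx hx'
      simp only [cc]
      rw [Int.emod_eq_of_lt hx hx']; omega
    have ea := e a (by omega) (by omega)
    have eb := e b (by omega) (by omega)
    have ec := e c (by omega) (by omega)
    have ed := e d (by omega) (by omega)
    refine hnc (cc M hM a) (cc M hM b) (cc M hM c) (cc M hM d) (Fin.lt_def.2 (by omega))
      (Fin.lt_def.2 (by omega)) (Fin.lt_def.2 (by omega)) _ (part_mem' π _) _ (part_mem' π _)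
      ?_ ?_ ?_ ?_
    · rw [mem_part_iff]
    · rw [mem_part_iff]; exact hac.symm
    · rw [mem_part_iff]
    · rw [mem_part_iff]; exact hbd.symm
  refine ⟨fun x => rfl, hsymm, htrans, ?_, ?_, ?_⟩
  · intro x
    have := hp x 1
    rwa [one_mul] at this
  · intro x y h
    unfold PR at h ⊢
    rw [← negB_cc, ← negB_cc, ← neg_part_of_closed π hneg, ← neg_part_of_closed π hneg, h]
  · -- cyclic non-crossing, first for `0 ≤ a < 2M`
    have hcyc : ∀ a b c d : ℤ, 0 ≤ a → a < 2 * M → a < b → b < c → c < d → d < a + 2 * M →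
        PR M hM π a c → PR M hM π b d → PR M hM π a b := by
      intro a b c d h0 h00 h1 h2 h3 h4 hac hbd
      have pm : ∀ x : ℤ, PR M hM π x (x - 2 * M) := by
        intro x
        have := hp x (-1)
        rwa [show x + -1 * (2 * (M : ℤ)) = x - 2 * M by ring] at this
      by_cases d2 : d < 2 * M
      · exact hlin a b c d h0 h1 h2 h3 d2 hac hbd
      have hbd' := htrans _ _ _ hbd (pm d)
      by_cases c2 : c < 2 * M
      · have := hlin (d - 2 * M) a b c (by omega) (by omega) (by omega) (by omega) (by omega)
          (hsymm _ _ hbd') hac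
        exact hsymm _ _ (htrans _ _ _ hbd' this)
      have hac' := htrans _ _ _ hac (pm c)
      by_cases b2 : b < 2 * M
      · have := hlin (c - 2 * M) (d - 2 * M) a b (by omega) (by omega) (by omega) (by omega) (by omega)
          (hsymm _ _ hac') (hsymm _ _ hbd')
        exact htrans _ _ _ hac' (htrans _ _ _ this (hsymm _ _ hbd'))
      · have := hlin (b - 2 * M) (c - 2 * M) (d - 2 * M) a (by omega) (by omega) (by omega)
          (by omega) (by omega) (htrans _ _ _ (hsymm _ _ (pm b)) hbd') (hsymm _ _ hac')
        exact htrans _ _ _ hac' (htrans _ _ _ (hsymm _ _ this) (hsymm _ _ (pm b)))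
    intro a b c d h1 h2 h3 h4 hac hbd
    obtain ⟨q, q1, q2⟩ := exists_shift (m := M) (by omega) (M : ℤ) a
    have mv : ∀ x y, PR M hM π x y →
        PR M hM π (x + q * (2 * (M : ℤ))) (y + q * (2 * (M : ℤ))) := by
      intro x y h
      exact htrans _ _ _ (hsymm _ _ (hp x q)) (htrans _ _ _ h (hp y q))
    have := hcyc (a + q * (2 * (M : ℤ))) (b + q * (2 * (M : ℤ))) (c + q * (2 * (M : ℤ)))
      (d + q * (2 * (M : ℤ))) (by linarith) (by linarith) (by linarith) (by linarith) (by linarith)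
      (by linarith) (mv _ _ hac) (mv _ _ hbd)
    exact htrans _ _ _ (hp a q) (htrans _ _ _ this (hsymm _ _ (hp b q)))

theorem card_block {M : ℕ} (hM : 0 < M) (π : Finpartition (Finset.univ : Finset (Fin (2 * M))))
    {Z : ℤ → Prop} {o : ℤ → ℤ} (h : OpAx M Z o) (hl : Link M (PR M hM π) Z o) (x : ℤ)
    (hx : ¬ Z x) : (π.part (cc M hM x)).card = (fib M Z o (o x)).card := by
  have hm : (0 : ℤ) < M := by omega
  symm
  refine Finset.card_bij (fun y _ => cc M hM y) ?_ ?_ ?_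
  · intro y hy
    rw [mem_fib] at hy
    rw [mem_part_iff]
    refine (hl y x).2 (Or.inr ⟨hy.2.1, hx, 0, by rw [hy.2.2]; ring⟩)
  · intro y hy y' hy' hE
    rw [mem_fib] at hy hy'
    obtain ⟨q, hq⟩ := cc_val hM y
    obtain ⟨r, hr⟩ := cc_val hM y'
    rw [hE] at hq
    have := q_cases hm (d := y - y') (q := r - q) (by linarith) (by omega) (by omega)
    omega
  · intro u hu
    rw [mem_part_iff] at hu
    rw [← cc_coe hM u] at hu
    rcases (hl _ _).1 hu with h1 | ⟨h1, _, q, hq⟩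
    · exact absurd h1.2 hx
    · have hp := h.perq (u.val : ℤ) (-q)
      have h2 := hp.2 h1
      have hZ : ¬ Z ((u.val : ℤ) + -q * (2 * (M : ℤ))) := by rwa [hp.1]
      have h3 := h.le _ hZ
      have h4 := h.lt _ hZ
      have h5 : o ((u.val : ℤ) + -q * (2 * (M : ℤ))) = o x := by rw [h2, hq]; ring
      refine ⟨(u.val : ℤ) + -q * (2 * (M : ℤ)), ?_, by rw [cc_shift, cc_coe]⟩
      rw [mem_fib]
      exact ⟨⟨by omega, by omega⟩, hZ, h5⟩

theorem exists_partition {M : ℕ} (hM : 0 < M) {Z : ℤ → Prop} {o : ℤ → ℤ} (h : OpAx M Z o) :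
    ∃ π : Finpartition (Finset.univ : Finset (Fin (2 * M))), Link M (PR M hM π) Z o := by
  classical
  obtain ⟨F, hF⟩ : ∃ F : ℤ → ℤ → Prop, ∀ x y, F x y ↔
    ((Z x ∧ Z y) ∨ (¬ Z x ∧ ¬ Z y ∧ ∃ q : ℤ, o x = o y + q * (2 * (M : ℤ)))) := ⟨_, fun _ _ => Iff.rfl⟩
  have frefl : ∀ x, F x x := by
    intro x
    rw [hF]
    by_cases hx : Z x
    · exact Or.inl ⟨hx, hx⟩
    · exact Or.inr ⟨hx, hx, 0, by simp⟩
  have fsymm : ∀ {x y}, F x y → F y x := by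
    intro x y hxy
    rw [hF] at hxy ⊢
    rcases hxy with ⟨a, b⟩ | ⟨a, b, q, hq⟩
    · exact Or.inl ⟨b, a⟩
    · exact Or.inr ⟨b, a, -q, by rw [hq]; ring⟩
  have ftrans : ∀ {x y z}, F x y → F y z → F x z := by
    intro x y z hxy hyz
    rw [hF] at hxy hyz ⊢
    rcases hxy with ⟨a, b⟩ | ⟨a, b, q, hq⟩ <;> rcases hyz with ⟨a', b'⟩ | ⟨a', b', q', hq'⟩
    · exact Or.inl ⟨a, b'⟩
    · exact absurd b a'
    · exact absurd a' b
    · exact Or.inr ⟨a, b', q + q', by rw [hq, hq']; ring⟩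
  have fshift : ∀ x q, F x (x + q * (2 * (M : ℤ))) := by
    intro x q
    have hp := h.perq x q
    rw [hF, hp.1]
    by_cases hx : Z x
    · exact Or.inl ⟨hx, hx⟩
    · exact Or.inr ⟨hx, hx, -q, by rw [hp.2 hx]; ring⟩
  let s : Setoid (Fin (2 * M)) := ⟨fun u v => F u.val v.val,
    ⟨fun _ => frefl _, fun h => fsymm h, fun h h' => ftrans h h'⟩⟩
  refine ⟨Finpartition.ofSetoid s, ?_⟩
  intro x y
  rw [← hF]
  unfold PR
  rw [eq_comm, ← mem_part_iff, Finpartition.mem_part_ofSetoid_iff_rel]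
  change F (cc M hM x).val (cc M hM y).val ↔ F x y
  obtain ⟨q, hq⟩ := cc_val hM x
  obtain ⟨r, hr⟩ := cc_val hM y
  rw [hq, hr]
  constructor
  · intro hxy
    exact ftrans (fshift x q) (ftrans hxy (fsymm (fshift y r)))
  · intro hxy
    exact ftrans (fsymm (fshift x q)) (ftrans hxy (fshift y r))

theorem eq_of_PR {M : ℕ} (hM : 0 < M) (π π' : Finpartition (Finset.univ : Finset (Fin (2 * M))))
    (h : ∀ x y, PR M hM π x y ↔ PR M hM π' x y) : π = π' := by
  have hp : ∀ u, π.part u = π'.part u := by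
    intro u
    ext v
    rw [mem_part_iff, mem_part_iff]
    have := h (v.val : ℤ) (u.val : ℤ)
    unfold PR at this
    simpa only [cc_coe] using this
  ext B
  constructor
  · intro hB
    obtain ⟨u, rfl⟩ := exists_part π hB
    rw [hp]; exact part_mem' _ _
  · intro hB
    obtain ⟨u, rfl⟩ := exists_part π' hB
    rw [← hp]; exact part_mem' _ _

theorem fib_card_shift {m : ℤ} {Z : ℤ → Prop} {o : ℤ → ℤ} (h : OpAx m Z o) (i : ℤ) :
    (fib m Z o (i + m)).card = (fib m Z o i).card := by
  symm
  refine Finset.card_bij (fun y _ => y + m) ?_ ?_ ?_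
  · intro y hy
    rw [mem_fib] at hy ⊢
    refine ⟨⟨by omega, by omega⟩, by rw [h.perZ]; exact hy.2.1, ?_⟩
    rw [h.per _ hy.2.1, hy.2.2]
  · intro y _ y' _ hE
    simpa using hE
  · intro y hy
    rw [mem_fib] at hy
    have hz := h.perZ (y - m)
    rw [sub_add_cancel] at hz
    have hZ : ¬ Z (y - m) := by rw [← hz]; exact hy.2.1
    have hp := h.per _ hZ
    rw [sub_add_cancel] at hp
    refine ⟨y - m, ?_, by simp⟩
    rw [mem_fib]
    exact ⟨⟨by omega, by omega⟩, hZ, by omega⟩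

theorem per_mod {m : ℤ} (g : ℤ → ℕ) (hg : ∀ x, g (x + m) = g x) (x : ℤ) : g (x % m) = g x := by
  have key : ∀ q : ℤ, ∀ x, g (x + q * m) = g x := by
    intro q
    induction q using Int.induction_on with
    | zero => simp
    | succ i ih => intro x; rw [show x + ((i : ℤ) + 1) * m = x + i * m + m by ring, hg, ih]
    | pred i ih =>
      intro x
      rw [← ih x, ← hg]; congr 1; ring
  have e := Int.emod_add_mul_ediv x m
  have := key (x / m) (x % m)
  rw [← this]; congr 1; linarith

theorem fil_mem {α : Type*} (s : Finset α) (p : α → Prop) (x : α) : x ∈ fil s p ↔ x ∈ s ∧ p x := by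
  unfold fil; simp

theorem target_mem (n k t : ℕ) (π : Finpartition (Finset.univ : Finset (Fin (2 * (k * n))))) :
    π ∈ fil (NCBdiv k n) (fun π => zeroBlockSize π = 2 * (t * k)) ↔
      IsNoncrossing π ∧ (∀ B ∈ π.parts, negBlock B ∈ π.parts) ∧
        (π.parts.filter (fun B => negBlock B = B)).card ≤ 1 ∧ (∀ B ∈ π.parts, k ∣ B.card) ∧
        zeroBlockSize π = 2 * (t * k) := by
  simp only [fil_mem, NCBdiv, NCB, Finset.mem_univ, true_and, and_assoc]

/-- The fibre sizes attached to a partition. -/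
noncomputable def sz (M : ℕ) (hM : 0 < M) (π : Finpartition (Finset.univ : Finset (Fin (2 * M))))
    (i : ℤ) : ℕ :=
  (fib M (RZ M (PR M hM π)) (Ro M (PR M hM π)) i).card

theorem sz_props {n k t : ℕ} (hM : 0 < k * n)
    (π : Finpartition (Finset.univ : Finset (Fin (2 * (k * n)))))
    (h : π ∈ fil (NCBdiv k n) (fun π => zeroBlockSize π = 2 * (t * k))) :
    (∀ i, k ∣ sz _ hM π i) ∧ ∑ i ∈ Finset.Ico 0 ((k * n : ℕ) : ℤ), sz _ hM π i + t * k = k * n := by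
  classical
  rw [target_mem] at h
  obtain ⟨h1, h2, h3, h4, h5⟩ := h
  have hm : (0 : ℤ) < (k * n : ℕ) := by omega
  have hR := PR_relAx hM π h1 h2
  have hO := hR.opAx hm
  have hL := hR.link hm
  constructor
  · intro i
    unfold sz
    rcases Finset.eq_empty_or_nonempty (fib (k * n : ℕ) (RZ (k * n : ℕ) (PR _ hM π))
      (Ro (k * n : ℕ) (PR _ hM π)) i) with he | ⟨y, hy⟩
    · rw [he]; simp
    · rw [mem_fib] at hy
      have := card_block hM π hO hL y hy.2.1
      rw [hy.2.2] at this
      rw [← this]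
      exact h4 _ (part_mem' _ _)
  · have e := sum_fib hm hO
    rw [zeroBlockSize_eq π (neg_part_of_closed π h2), card_zero hM π hR.perZ] at h5
    unfold sz
    omega

theorem exists_of_sz {n k t : ℕ} (ht : 1 ≤ t) (hk : 1 ≤ k) (hM : 0 < k * n) (f : ℤ → ℕ)
    (hf : ∀ x, f (x + (k * n : ℕ)) = f x)
    (hs : ∑ i ∈ Finset.Ico 0 ((k * n : ℕ) : ℤ), f i + t = n) :
    ∃ π ∈ fil (NCBdiv k n) (fun π => zeroBlockSize π = 2 * (t * k)),
      ∀ i, sz _ hM π i = k * f i := by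
  classical
  have hm : (0 : ℤ) < (k * n : ℕ) := by omega
  have hsum : ∑ i ∈ Finset.Ico 0 ((k * n : ℕ) : ℤ), k * f i + t * k = k * n := by
    rw [← Finset.mul_sum]
    conv_rhs => rw [← hs]
    ring
  have htk : 0 < t * k := Nat.mul_pos ht hk
  obtain ⟨Z, o, hO, hfib⟩ := exists_OpAx hm (fun x => k * f x) (fun x => by simp only [hf]) (by
    rw [Finset.sum_sub_distrib, ← Nat.cast_sum]
    simp only [Finset.sum_const, Int.card_Ico, nsmul_eq_mul, mul_one]
    omega)
  obtain ⟨π, hL⟩ := exists_partition hM hO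
  have hZi := fun x => hL.Z_iff (by omega) hO x
  have hcongr : ∀ u v, π.part u = π.part v → π.part (negB u) = π.part (negB v) := by
    intro u v huv
    rw [← cc_coe hM u, ← cc_coe hM v] at huv ⊢
    rw [negB_cc, negB_cc]
    refine (hL _ _).2 ?_
    rw [hO.perZ, hO.perZ]
    rcases (hL _ _).1 huv with h1 | ⟨a, b, q, hq⟩
    · exact Or.inl h1
    · exact Or.inr ⟨a, b, q, by rw [hO.per _ a, hO.per _ b, hq]; ring⟩
  have hneg := neg_part_of_congr π hcongr
  have hzero : (Finset.univ.filter (fun u => π.part (negB u) = π.part u)).card = 2 * (t * k) := by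
    rw [card_zero hM π (fun x => by rw [hZi, hZi, hO.perZ])]
    have e := sum_fib hm hO
    simp only [hfib] at e
    have : (Finset.Ico (0 : ℤ) (k * n : ℕ)).filter (RZ (k * n : ℕ) (PR _ hM π))
      = (Finset.Ico (0 : ℤ) (k * n : ℕ)).filter Z := by
      apply Finset.filter_congr
      intro x _; exact hZi x
    rw [this]
    omega
  have hZu : ∀ u, π.part (negB u) = π.part u ↔ Z (u.val : ℤ) := by
    intro u
    rw [← hZi]
    unfold RZ PR
    rw [← negB_cc, cc_coe, eq_comm]
  have hsame : ∀ u v, Z ((u : Fin (2 * (k * n))).val : ℤ) → Z ((v : Fin (2 * (k * n))).val : ℤ) →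
      π.part u = π.part v := by
    intro u v hu hv
    have : PR _ hM π (u.val : ℤ) (v.val : ℤ) := (hL _ _).2 (Or.inl ⟨hu, hv⟩)
    unfold PR at this
    rwa [cc_coe, cc_coe] at this
  refine ⟨π, ?_, ?_⟩
  · rw [target_mem]
    refine ⟨?_, ?_, ?_, ?_, ?_⟩
    · intro a b c d hab hbc hcd B hB C hC haB hcB hbC hdC
      have e1 := π.part_eq_of_mem hB haB
      have e2 := π.part_eq_of_mem hB hcB
      have e3 := π.part_eq_of_mem hC hbC
      have e4 := π.part_eq_of_mem hC hdC
      rw [Fin.lt_def] at hab hbc hcd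
      have hd := d.isLt
      have := hO.noncrossing hm hL a.val b.val c.val d.val (by omega) (by omega) (by omega)
        (by omega) (by omega) (by unfold PR; rw [cc_coe, cc_coe, e1, e2])
        (by unfold PR; rw [cc_coe, cc_coe, e3, e4])
      unfold PR at this
      rw [cc_coe, cc_coe] at this
      rw [← e1, ← e3, this]
    · intro B hB
      obtain ⟨u, rfl⟩ := exists_part π hB
      rw [hneg]; exact part_mem' _ _
    · rw [Finset.card_le_one]
      intro B hB C hC
      rw [Finset.mem_filter] at hB hC
      obtain ⟨hB, hB'⟩ := hB
      obtain ⟨hC, hC'⟩ := hC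
      obtain ⟨u, rfl⟩ := exists_part π hB
      obtain ⟨v, rfl⟩ := exists_part π hC
      rw [hneg] at hB' hC'
      exact hsame u v ((hZu u).1 hB') ((hZu v).1 hC')
    · intro B hB
      obtain ⟨u, rfl⟩ := exists_part π hB
      by_cases hu : Z (u.val : ℤ)
      · have : π.part u = Finset.univ.filter (fun u => π.part (negB u) = π.part u) := by
          ext v
          rw [mem_part_iff]
          simp only [Finset.mem_filter, Finset.mem_univ, true_and]
          constructor
          · intro hv
            rw [hcongr v u hv, hv]; exact (hZu u).2 hu
          · intro hv
            exact hsame v u ((hZu v).1 hv) hu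
        rw [this, hzero]
        exact ⟨2 * t, by ring⟩
      · have := card_block hM π hO hL (u.val : ℤ) hu
        rw [cc_coe, hfib] at this
        rw [this]; exact Dvd.intro _ rfl
    · rw [zeroBlockSize_eq π hneg, hzero]
  · intro i
    unfold sz
    rw [hL.fib_eq hm hO, hfib]

theorem sz_inj {n k t : ℕ} (hM : 0 < k * n)
    (π π' : Finpartition (Finset.univ : Finset (Fin (2 * (k * n)))))
    (h : π ∈ fil (NCBdiv k n) (fun π => zeroBlockSize π = 2 * (t * k)))
    (h' : π' ∈ fil (NCBdiv k n) (fun π => zeroBlockSize π = 2 * (t * k)))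
    (hs : ∀ i ∈ Finset.Ico 0 ((k * n : ℕ) : ℤ), sz _ hM π i = sz _ hM π' i) : π = π' := by
  rw [target_mem] at h h'
  have hm : (0 : ℤ) < (k * n : ℕ) := by omega
  have hR := PR_relAx hM π h.1 h.2.1
  have hO := hR.opAx hm
  have hL := hR.link hm
  have hR' := PR_relAx hM π' h'.1 h'.2.1
  have hO' := hR'.opAx hm
  have hL' := hR'.link hm
  obtain ⟨u1, u2⟩ := hO.unique hO' (by
    intro i
    have e := per_mod (sz _ hM π) (fib_card_shift hO) i
    have e' := per_mod (sz _ hM π') (fib_card_shift hO') i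
    change sz _ hM π i = sz _ hM π' i
    rw [← e, ← e']
    exact hs _ (Finset.mem_Ico.2 ⟨Int.emod_nonneg _ hm.ne', Int.emod_lt_of_pos _ hm⟩))
  apply eq_of_PR hM
  intro x y
  rw [hL, hL', u1, u1]
  constructor
  · rintro (h | ⟨a, b, q, hq⟩)
    · exact Or.inl h
    · rw [← u1] at a b
      rw [u2 x a, u2 y b] at hq
      exact Or.inr ⟨by rwa [← u1], by rwa [← u1], q, hq⟩
  · rintro (h | ⟨a, b, q, hq⟩)
    · exact Or.inl h
    · refine Or.inr ⟨a, b, q, ?_⟩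
      rw [← u1] at a b
      rw [u2 x a, u2 y b, hq]

/-- **Theorem 2 (2).** The number of `k`-divisible non-crossing partitions of type
`B_{kn}` having a zero-block of cardinality `2tk` equals `binom(n(k+1)-t-1, nk-1)`. -/
theorem typeB_k_divisible_count_zeroBlock (n k t : ℕ) (hn : 1 ≤ n) (hk : 1 ≤ k)
    (ht1 : 1 ≤ t) (htn : t ≤ n) :
    (fil (NCBdiv k n) (fun π => zeroBlockSize π = 2 * (t * k))).card =
      Nat.choose (n * (k + 1) - t - 1) (n * k - 1) := by
  classical
  have hM : 0 < k * n := Nat.mul_pos hk hn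
  have hm : (0 : ℤ) < (k * n : ℕ) := by omega
  have hcard : (Finset.finsuppAntidiag (Finset.Ico 0 ((k * n : ℕ) : ℤ)) (n - t)).card
      = Nat.choose (n * (k + 1) - t - 1) (n * k - 1) := by
    rw [Finset.card_finsuppAntidiag_nat_eq_choose]
    simp only [Int.card_Ico, sub_zero, Int.toNat_natCast]
    rw [show n * (k + 1) - t - 1 = k * n + (n - t) - 1 by rw [mul_add, mul_comm n k]; omega,
      mul_comm n k]
    exact Nat.choose_symm_of_eq_add (by omega)
  rw [← hcard]
  refine Finset.card_bij
    (fun π _ => Finsupp.indicator (Finset.Ico 0 ((k * n : ℕ) : ℤ)) (fun i _ => sz _ hM π i / k))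
    ?_ ?_ ?_
  · intro π hπ
    obtain ⟨h1, h2⟩ := sz_props hM π hπ
    rw [Finset.mem_finsuppAntidiag]
    refine ⟨?_, Finsupp.support_indicator_subset _ _⟩
    have e : ∑ i ∈ Finset.Ico 0 ((k * n : ℕ) : ℤ), sz _ hM π i
        = k * ∑ i ∈ Finset.Ico 0 ((k * n : ℕ) : ℤ), sz _ hM π i / k := by
      rw [Finset.mul_sum]
      exact Finset.sum_congr rfl fun i _ => (Nat.mul_div_cancel' (h1 i)).symm
    have e2 : ∑ i ∈ Finset.Ico 0 ((k * n : ℕ) : ℤ), sz _ hM π i / k + t = n := by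
      apply Nat.eq_of_mul_eq_mul_left hk
      rw [mul_add, ← e, mul_comm k t, h2]
    have e3 : ∑ i ∈ Finset.Ico 0 ((k * n : ℕ) : ℤ),
        (Finsupp.indicator (Finset.Ico 0 ((k * n : ℕ) : ℤ)) (fun i _ => sz _ hM π i / k)) i
        = ∑ i ∈ Finset.Ico 0 ((k * n : ℕ) : ℤ), sz _ hM π i / k :=
      Finset.sum_congr rfl fun i hi => Finsupp.indicator_of_mem hi _
    rw [e3]; omega
  · intro π hπ π' hπ' hE
    apply sz_inj hM π π' hπ hπ'
    intro i hi
    have := DFunLike.congr_fun hE i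
    rw [Finsupp.indicator_of_mem hi, Finsupp.indicator_of_mem hi] at this
    rw [← Nat.mul_div_cancel' ((sz_props hM π hπ).1 i), this,
      Nat.mul_div_cancel' ((sz_props hM π' hπ').1 i)]
  · intro f hf
    rw [Finset.mem_finsuppAntidiag] at hf
    have hmod : ∀ i ∈ Finset.Ico 0 ((k * n : ℕ) : ℤ), i % ((k * n : ℕ) : ℤ) = i := by
      intro i hi
      rw [Finset.mem_Ico] at hi
      exact Int.emod_eq_of_lt hi.1 hi.2
    obtain ⟨π, hπ, hs⟩ := exists_of_sz (t := t) ht1 hk hM (fun x => f (x % ((k * n : ℕ) : ℤ)))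
      (fun x => by simp only [Int.add_emod_right]) (by
        rw [Finset.sum_congr rfl (fun i hi => by rw [hmod i hi]), hf.1]
        omega)
    refine ⟨π, hπ, ?_⟩
    ext i
    by_cases hi : i ∈ Finset.Ico 0 ((k * n : ℕ) : ℤ)
    · rw [Finsupp.indicator_of_mem hi, hs, hmod i hi, Nat.mul_div_cancel_left _ hk]
    · rw [Finsupp.indicator_of_notMem hi]
      symm
      exact Finsupp.notMem_support_iff.1 (fun hc => hi (hf.2 hc))
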